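/- For every odd integer γ ≥ 3 there exists a set S of n = 2γ+1 distinct labeled points of the Euclidean plane ℝ² such that: (a) S admits a ball-cover condensing of size 2, i.e. a two-element subset T ⊆ S with radii r : T → (0,∞) satisfying r(p), r(q) < ‖p−q‖ whenever p, q ∈ T have opposite labels, and such that every point of S lies in the open ball B(p, r(p)) for some p ∈ T with the same label; and (b) every subset T′ ⊆ S that is NN-consistent with S has cardinality at least n − 2. -/

import Mathlib

noncomputable section
open Classical

/-- The Euclidean plane. -/
abbrev Pt := EuclideanSpace ℝ (Fin 2)

/-- `T` is NN-consistent with `S` (labels given by `l`). -/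
def NNConsistent (l : Pt → Bool) (S T : Finset Pt) : Prop :=
  ∀ p ∈ S, ∃ q ∈ T, l q = l p ∧ ∀ q' ∈ T, l q' ≠ l p → dist p q ≤ dist p q'

/-- The point of the first coordinate axis with the given natural coordinate. -/
def axisPt (k : ℕ) : Pt := !₂[(k : ℝ), 0]

/-- The parity of the integer part of the first coordinate. -/
def parityLabel (x : Pt) : Bool := decide (Even ⌊x 0⌋)

lemma dist_axisPt (a b : ℕ) : dist (axisPt a) (axisPt b) = |(a : ℝ) - b| := by
  simp [axisPt, EuclideanSpace.dist_eq, Real.dist_eq, Real.sqrt_sq_eq_abs]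

lemma axisPt_injective : Function.Injective axisPt := by
  intro a b h
  have h0 := congrArg (fun x : Pt => x 0) h
  simpa [axisPt] using h0

lemma parityLabel_axisPt (k : ℕ) : parityLabel (axisPt k) = decide (Even k) := by
  simp [parityLabel, axisPt]

lemma dist_axisPt_le_iff (k a b : ℕ) :
    dist (axisPt k) (axisPt a) ≤ dist (axisPt k) (axisPt b) ↔
      |(k : ℤ) - a| ≤ |(k : ℤ) - b| := by
  rw [dist_axisPt, dist_axisPt]
  exact_mod_cast Iff.rfl

/-- The coordinates of a run of consecutive integers together with two far away points of
opposite parities. -/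
def coords (γ : ℕ) : Finset ℕ := insert 0 (insert (10 * γ + 1) (Finset.Ico (6 * γ) (8 * γ - 1)))

lemma mem_coords {γ k : ℕ} :
    k ∈ coords γ ↔ k = 0 ∨ k = 10 * γ + 1 ∨ (6 * γ ≤ k ∧ k < 8 * γ - 1) := by
  simp [coords]

lemma card_coords {γ : ℕ} (hγ : 3 ≤ γ) : (coords γ).card = 2 * γ + 1 := by
  unfold coords
  rw [Finset.card_insert_of_notMem, Finset.card_insert_of_notMem, Nat.card_Ico]
  · omega
  · simp only [Finset.mem_Ico]; omega
  · simp only [Finset.mem_insert, Finset.mem_Ico]; omega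

/-- NN-consistency of a set of points on the axis, in terms of coordinates. -/
lemma NNConsistent.exists_coord {A B : Finset ℕ}
    (h : NNConsistent parityLabel (A.image axisPt) (B.image axisPt)) {k : ℕ} (hk : k ∈ A) :
    ∃ a ∈ B, (Even a ↔ Even k) ∧
      ∀ b ∈ B, ¬(Even b ↔ Even k) → |(k : ℤ) - a| ≤ |(k : ℤ) - b| := by
  obtain ⟨q, hq, hl, hd⟩ := h _ (Finset.mem_image_of_mem _ hk)
  obtain ⟨a, ha, rfl⟩ := Finset.mem_image.1 hq
  refine ⟨a, ha, by simpa [parityLabel_axisPt] using hl, fun b hb hne => ?_⟩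
  refine (dist_axisPt_le_iff k a b).1 (hd _ (Finset.mem_image_of_mem _ hb) ?_)
  simpa [parityLabel_axisPt] using hne

/-- Omitting one point of the run forces its two neighbours to be omitted as well. -/
lemma neighbours_notMem {A B : Finset ℕ}
    (h : NNConsistent parityLabel (A.image axisPt) (B.image axisPt)) {k j : ℕ}
    (hk : k ∈ A) (hkB : k ∉ B) (hj : j = k + 1 ∨ k = j + 1) : j ∉ B := by
  intro hjB
  obtain ⟨a, ha, hpar, hd⟩ := h.exists_coord hk
  have hle := hd j hjB (by rw [Nat.even_iff, Nat.even_iff]; omega)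
  have hne : a ≠ k := fun e => hkB (e ▸ ha)
  rw [Nat.even_iff, Nat.even_iff] at hpar
  rcases abs_cases ((k : ℤ) - a) with h1 | h1 <;>
    rcases abs_cases ((k : ℤ) - j) with h2 | h2 <;> omega

lemma run_subset_of_nnConsistent {γ : ℕ} (hγ : 3 ≤ γ) {B : Finset ℕ} (hB : B ⊆ coords γ)
    (h : NNConsistent parityLabel ((coords γ).image axisPt) (B.image axisPt)) :
    Finset.Ico (6 * γ) (8 * γ - 1) ⊆ B := by
  have hmem : ∀ i < 2 * γ - 1, 6 * γ + i ∈ coords γ := fun i hi => mem_coords.2 (by omega)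
  have hfirst : 6 * γ ∈ B := by
    by_contra h0
    have hall : ∀ i < 2 * γ - 1, 6 * γ + i ∉ B := by
      intro i
      induction i with
      | zero => exact fun _ => h0
      | succ i ih =>
        exact fun hi => neighbours_notMem h (hmem i (by omega)) (ih (by omega)) (Or.inl rfl)
    have hfar : ∀ a ∈ B, a = 0 ∨ a = 10 * γ + 1 := by
      intro a ha
      rcases mem_coords.1 (hB ha) with h1 | h1 | h1
      · exact Or.inl h1
      · exact Or.inr h1
      · refine absurd ha ?_
        have := hall (a - 6 * γ) (by omega)
        rwa [Nat.add_sub_cancel' h1.1] at this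
    obtain ⟨a, ha, hae, had⟩ := h.exists_coord (hmem 0 (by omega))
    obtain ⟨b, hb, hbe, -⟩ := h.exists_coord (hmem 1 (by omega))
    rw [Nat.even_iff, Nat.even_iff] at hae hbe
    have hle := had b hb (by rw [Nat.even_iff, Nat.even_iff]; omega)
    have ha0 : a = 0 := by have := hfar a ha; omega
    have hbL : b = 10 * γ + 1 := by have := hfar b hb; omega
    subst ha0 hbL
    grind
  have hall : ∀ i < 2 * γ - 1, 6 * γ + i ∈ B := by
    intro i
    induction i with
    | zero => exact fun _ => hfirst
    | succ i ih =>
      intro hi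
      by_contra hn
      exact neighbours_notMem h (hmem _ hi) hn (Or.inr rfl) (ih (by omega))
  intro a ha
  rw [Finset.mem_Ico] at ha
  have := hall (a - 6 * γ) (by omega)
  rwa [Nat.add_sub_cancel' ha.1] at this

/-- For every odd `γ ≥ 3` there is a set of `n = 2γ+1` distinct labeled points of the
plane admitting a ball-cover condensing of size 2, while every NN-consistent subset
has at least `n - 2` points. -/
theorem stmt2 (γ : ℕ) (hodd : Odd γ) (hγ : 3 ≤ γ) :
    ∃ (S : Finset Pt) (l : Pt → Bool),
      S.card = 2 * γ + 1 ∧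
      (∃ T ⊆ S, T.card = 2 ∧ ∃ r : Pt → ℝ,
        (∀ p ∈ T, 0 < r p) ∧
        (∀ p ∈ T, ∀ q ∈ T, l p ≠ l q → r p < dist p q ∧ r q < dist p q) ∧
        (∀ x ∈ S, ∃ p ∈ T, l p = l x ∧ x ∈ Metric.ball p (r p))) ∧
      (∀ T' ⊆ S, NNConsistent l S T' → (2 * γ + 1) - 2 ≤ T'.card) := by
  refine ⟨(coords γ).image axisPt, parityLabel, ?_, ?_, ?_⟩
  · rw [Finset.card_image_of_injective _ axisPt_injective, card_coords hγ]
  · have hpos : 0 < γ := by omega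
    refine ⟨({0, 10 * γ + 1} : Finset ℕ).image axisPt, ?_, ?_, fun _ => (10 * γ : ℝ), ?_, ?_, ?_⟩
    · refine Finset.image_subset_image fun k hk => mem_coords.2 ?_
      simp only [Finset.mem_insert, Finset.mem_singleton] at hk
      omega
    · rw [Finset.card_image_of_injective _ axisPt_injective]
      exact Finset.card_pair (by omega)
    · intro p _
      positivity
    · have hd : (10 * γ : ℝ) < dist (axisPt 0) (axisPt (10 * γ + 1)) := by
        rw [dist_comm, dist_axisPt]
        push_cast
        rw [sub_zero, abs_of_nonneg (by positivity)]
        linarith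
      simp only [Finset.mem_image, Finset.mem_insert, Finset.mem_singleton]
      rintro _ ⟨a, rfl | rfl, rfl⟩ _ ⟨b, rfl | rfl, rfl⟩ hne
      · exact absurd rfl hne
      · exact ⟨hd, hd⟩
      · rw [dist_comm]
        exact ⟨hd, hd⟩
      · exact absurd rfl hne
    · intro x hx
      obtain ⟨k, hk, rfl⟩ := Finset.mem_image.1 hx
      rw [mem_coords] at hk
      by_cases hev : Even k
      · refine ⟨axisPt 0, Finset.mem_image_of_mem _ (by simp), ?_, ?_⟩
        · simp [parityLabel_axisPt, hev]
        · have hlt : k < 10 * γ := by rw [Nat.even_iff] at hev; omega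
          rw [Metric.mem_ball, dist_axisPt, Nat.cast_zero, sub_zero, Nat.abs_cast]
          beta_reduce
          exact_mod_cast hlt
      · refine ⟨axisPt (10 * γ + 1), Finset.mem_image_of_mem _ (by simp), ?_, ?_⟩
        · have hL : ¬ Even (10 * γ + 1) := by rw [Nat.even_iff]; omega
          simp only [parityLabel_axisPt, hev, hL]
        · have hlt : 1 < k ∧ k ≤ 10 * γ + 1 := by rw [Nat.even_iff] at hev; omega
          have h1 : (1 : ℝ) < k := by exact_mod_cast hlt.1
          have h2 : (k : ℝ) ≤ 10 * γ + 1 := by exact_mod_cast hlt.2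
          rw [Metric.mem_ball, dist_axisPt, abs_lt]
          push_cast
          constructor <;> linarith
  · intro T' hT' hT'c
    obtain ⟨B, hB, rfl⟩ := Finset.subset_image_iff.1 hT'
    have hcard := Finset.card_le_card (run_subset_of_nnConsistent hγ (by exact_mod_cast hB) hT'c)
    rw [Nat.card_Ico] at hcard
    rw [Finset.card_image_of_injective _ axisPt_injective]
    omega
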